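/- Let C be a connected component of the Φ-graph on S_{λ,μ} and let (w,α) ∈ C. Then for every permutation u ∈ S_n with u ≤ w in the left weak Bruhat order, there exists a Kostant partition β such that (u,β) ∈ C. In particular, every connected component of the Φ-graph is a subgraph of the Cayley graph of S_n whose underlying set of permutations is downward closed under the left weak Bruhat order. -/

import Mathlib

open scoped BigOperators

namespace KFC

/-- A (candidate) root is a pair of 1-based indices. -/
abbrev Root : Type := ℕ × ℕ

/-- A Kostant partition is encoded as a multiplicity function on pairs. -/
abbrev KPf : Type := Root → ℕ

/-- An entry of a signed word: a sign (`true` = '+', `false` = '−') together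
with the root lying under it. -/
abbrev Entry : Type := Bool × Root

/-- `p` is a positive root of type `A_{n-1}`. -/
def IsPos (n : ℕ) (p : Root) : Prop := 1 ≤ p.1 ∧ p.1 < p.2 ∧ p.2 ≤ n

/-- `α` is a genuine Kostant partition for type `A_{n-1}`: it is supported on
positive roots. -/
def IsKP (n : ℕ) (α : KPf) : Prop := ∀ p, α p ≠ 0 → IsPos n p

/-- Add one copy of the root `r`. -/
def KPadd (α : KPf) (r : Root) : KPf := fun p => if p = r then α p + 1 else α p

/-- Remove one copy of the root `r`. -/
def KPsub (α : KPf) (r : Root) : KPf := fun p => if p = r then α p - 1 else α p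

/-- Replace one copy of `r` by one copy of `r'`. -/
def KPmove (α : KPf) (r r' : Root) : KPf := KPadd (KPsub α r) r'

/-- The signed word `W_i` of `α`: roots `(a,b)` ordered by decreasing `a` and,
for equal `a`, increasing `b`; a '+' under each `(h,i)` and a '−' under each
`(h,i+1)`. -/
def Wword (n i : ℕ) (α : KPf) : List Entry :=
  ((List.range (n+1)).reverse).flatMap (fun h =>
    List.replicate (α (h, i)) ((true, (h, i)) : Entry) ++
    List.replicate (α (h, i+1)) ((false, (h, i+1)) : Entry))

/-- The signed word `W_i*` of `α`: roots `(a,b)` ordered by increasing `b` and,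
for equal `b`, decreasing `a`; a '+' under each `(i+1,j)` and a '−' under each
`(i,j)`. -/
def Wstar (n i : ℕ) (α : KPf) : List Entry :=
  (List.range (n+1)).flatMap (fun j =>
    List.replicate (α (i+1, j)) ((true, (i+1, j)) : Entry) ++
    List.replicate (α (i, j)) ((false, (i, j)) : Entry))

/-- One step of the left-to-right reduction: a new '+' cancels the rightmost
surviving '−' (the surviving word always has the shape `+^a −^b`). -/
def redStep (s : List Entry) (e : Entry) : List Entry :=
  match e.1, s.getLast? with
  | true, some (false, _) => s.dropLast
  | _, _ => s ++ [e]

/-- The reduced word (list of surviving entries, in order). -/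
def reduceW (w : List Entry) : List Entry := w.foldl redStep []

def plusCt (w : List Entry) : ℕ := (w.filter (fun e => e.1)).length
def minusCt (w : List Entry) : ℕ := (w.filter (fun e => !e.1)).length

/-- `a_i`: number of '+' in the reduced word of `W_i`. -/
def aSt (n i : ℕ) (α : KPf) : ℕ := plusCt (reduceW (Wword n i α))
/-- `b_i`: number of '−' in the reduced word of `W_i`. -/
def bSt (n i : ℕ) (α : KPf) : ℕ := minusCt (reduceW (Wword n i α))
/-- `a_i*`. -/
def aStar (n i : ℕ) (α : KPf) : ℕ := plusCt (reduceW (Wstar n i α))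
/-- `b_i*`. -/
def bStar (n i : ℕ) (α : KPf) : ℕ := minusCt (reduceW (Wstar n i α))
/-- `u_i`: number of '+' in the reduced word of `W_i* W_i`. -/
def uSt (n i : ℕ) (α : KPf) : ℕ := plusCt (reduceW (Wstar n i α ++ Wword n i α))
/-- `v_i`: number of '−' in the reduced word of `W_i* W_i`. -/
def vSt (n i : ℕ) (α : KPf) : ℕ := minusCt (reduceW (Wstar n i α ++ Wword n i α))

/-- The root under the rightmost surviving '+'. -/
def lastPlus (w : List Entry) : Option Root :=
  (((reduceW w).filter (fun e => e.1)).getLast?).map Prod.snd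

/-- The root under the leftmost surviving '−'. -/
def headMinus (w : List Entry) : Option Root :=
  (((reduceW w).filter (fun e => !e.1)).head?).map Prod.snd

/-- The operator `f̃_i`. -/
def ftilde (n i : ℕ) (α : KPf) : Option KPf :=
  match lastPlus (Wword n i α) with
  | some r => some (KPmove α r (r.1, i+1))
  | none => some (KPadd α (i, i+1))

/-- The operator `ẽ_i`. -/
def etilde (n i : ℕ) (α : KPf) : Option KPf :=
  match headMinus (Wword n i α) with
  | some r => if r = (i, i+1) then some (KPsub α (i, i+1)) else some (KPmove α r (r.1, i))
  | none => none

/-- The operator `f̃_i*`. -/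
def ftildeS (n i : ℕ) (α : KPf) : Option KPf :=
  match lastPlus (Wstar n i α) with
  | some r => some (KPmove α r (i, r.2))
  | none => some (KPadd α (i, i+1))

/-- The operator `ẽ_i*`. -/
def etildeS (n i : ℕ) (α : KPf) : Option KPf :=
  match headMinus (Wstar n i α) with
  | some r => if r = (i, i+1) then some (KPsub α (i, i+1)) else some (KPmove α r (i+1, r.2))
  | none => none

/-- The modified operator `f_i`. -/
def fop (n i : ℕ) (α : KPf) : Option KPf :=
  if bStar n i α < aSt n i α then ftilde n i α
  else if 0 < aStar n i α then ftildeS n i α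
  else none

/-- The modified operator `e_i`. -/
def eop (n i : ℕ) (α : KPf) : Option KPf :=
  if bStar n i α ≤ aSt n i α then
    (if 0 < bSt n i α ∧ headMinus (Wword n i α) ≠ some (i, i+1) then etilde n i α else none)
  else
    (if headMinus (Wstar n i α) ≠ some (i, i+1) then etildeS n i α else none)

/-- The operator `ê_i`. -/
def ehat (n i : ℕ) (α : KPf) : Option KPf :=
  if bStar n i α ≤ aSt n i α then (if 0 < bSt n i α then etilde n i α else none)
  else etildeS n i α

/-- Iterate a partially defined operator (`none` plays the role of `0`). -/
def iterO (g : KPf → Option KPf) : ℕ → KPf → Option KPf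
  | 0, x => some x
  | k+1, x => (g x).bind (iterO g k)

/-- `ε_i(x) = max {k : e_i^k x ≠ 0}`. -/
noncomputable def epsS (n i : ℕ) (x : KPf) : ℕ := sSup {k | iterO (eop n i) k x ≠ none}
/-- `ε̂_i(x) = max {k : ê_i^k x ≠ 0}`. -/
noncomputable def epsHatS (n i : ℕ) (x : KPf) : ℕ := sSup {k | iterO (ehat n i) k x ≠ none}
/-- `φ_i(x) = max {k : f_i^k x ≠ 0}`. -/
noncomputable def phiS (n i : ℕ) (x : KPf) : ℕ := sSup {k | iterO (fop n i) k x ≠ none}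

noncomputable def epsO (n i : ℕ) (o : Option KPf) : ℕ := o.elim 0 (epsS n i)
noncomputable def epsHatO (n i : ℕ) (o : Option KPf) : ℕ := o.elim 0 (epsHatS n i)
noncomputable def phiO (n i : ℕ) (o : Option KPf) : ℕ := o.elim 0 (phiS n i)

/-- `e_l(γ) ≃ 0`. -/
def simZero (n l : ℕ) (γ : KPf) : Prop := eop n l γ ≠ ehat n l γ

/-- `e_l e_m (γ) ≃ 0`. -/
def simZero2 (n l m : ℕ) (γ : KPf) : Prop := ∃ δ, eop n m γ = some δ ∧ simZero n l δ

/-- The box containing all relevant pairs. -/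
def kbox (n : ℕ) : Finset (ℕ × ℕ) := Finset.range (n+1) ×ˢ Finset.range (n+1)

/-- `|α|`: number of parts of the Kostant partition. -/
def kpSize (n : ℕ) (α : KPf) : ℕ := ∑ p ∈ kbox n, α p

/-- The evaluation `ᾱ ∈ ℤ^n` (as a function on 1-based coordinates). -/
def kpEval (n : ℕ) (α : KPf) : ℕ → ℤ :=
  fun k => ∑ p ∈ kbox n, (α p : ℤ) * ((if p.1 = k then 1 else 0) - (if p.2 = k then 1 else 0))

/-- The simple root `α_i = ε_i − ε_{i+1}` as a vector. -/
def srVec (i : ℕ) : ℕ → ℤ := fun k => (if k = i then 1 else 0) - (if k = i+1 then 1 else 0)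

/-- `ρ = (n-1, n-2, …, 1, 0)` (on 1-based coordinates `1..n`). -/
def rhoVec (n : ℕ) : ℕ → ℤ := fun k => (n : ℤ) - k

/-- `⟨γ, α_i^∨⟩ = γ_i − γ_{i+1}`. -/
def pairCo (γ : ℕ → ℤ) (i : ℕ) : ℤ := γ i - γ (i+1)

/-- The permutation of 1-based coordinates induced by `w : Perm (Fin n)`. -/
def extP (n : ℕ) (w : Equiv.Perm (Fin n)) (k : ℕ) : ℕ :=
  if h : 1 ≤ k ∧ k ≤ n then ((w ⟨k - 1, by omega⟩ : Fin n) : ℕ) + 1 else k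

/-- `S_n` acting on `ℤ^n` by permuting coordinates: `(w·v)_k = v_{w⁻¹(k)}`. -/
def permAct (n : ℕ) (w : Equiv.Perm (Fin n)) (v : ℕ → ℤ) : ℕ → ℤ :=
  fun k => v (extP n w⁻¹ k)

/-- The simple transposition `s_i = (i, i+1)` (1-based). -/
def sT (n i : ℕ) : Equiv.Perm (Fin n) :=
  if h : 1 ≤ i ∧ i < n then Equiv.swap ⟨i - 1, by omega⟩ ⟨i, h.2⟩ else 1

/-- Coxeter length = number of inversions. -/
def lenP (n : ℕ) (w : Equiv.Perm (Fin n)) : ℕ :=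
  (Finset.univ.filter (fun p : Fin n × Fin n => p.1 < p.2 ∧ w p.2 < w p.1)).card

/-- The left weak Bruhat order: `u ≤ w` iff `ℓ(w) = ℓ(w u⁻¹) + ℓ(u)`. -/
def leftWeakLE (n : ℕ) (u w : Equiv.Perm (Fin n)) : Prop :=
  lenP n w = lenP n (w * u⁻¹) + lenP n u

/-- `λ + ρ` as a vector. -/
def lamRho (n : ℕ) (lam : ℕ → ℤ) : ℕ → ℤ := fun k => lam k + rhoVec n k

/-- `(w, α) ∈ S_{λ,μ}`, i.e. `ᾱ = w(λ+ρ) − (μ+ρ)`. -/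
def InS (n : ℕ) (lam mu : ℕ → ℤ) (w : Equiv.Perm (Fin n)) (α : KPf) : Prop :=
  IsKP n α ∧ ∀ k, 1 ≤ k → k ≤ n →
    kpEval n α k = permAct n w (lamRho n lam) k - (mu k + rhoVec n k)

/-- A directed edge `(w,α) →^i (s_i w, β)` of the `Φ`-graph. -/
def PhiEdge (n : ℕ) (lam mu : ℕ → ℤ) (v v' : Equiv.Perm (Fin n) × KPf) : Prop :=
  InS n lam mu v.1 v.2 ∧ InS n lam mu v'.1 v'.2 ∧
  ∃ i, 1 ≤ i ∧ i ≤ n - 1 ∧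
    pairCo (permAct n v.1 (lamRho n lam)) i < 0 ∧
    v'.1 = sT n i * v.1 ∧
    iterO (fop n i) (-(pairCo (permAct n v.1 (lamRho n lam)) i)).toNat v.2 = some v'.2

/-- Being in the same connected component of (the underlying undirected graph of)
the `Φ`-graph. -/
def Conn (n : ℕ) (lam mu : ℕ → ℤ) (v v' : Equiv.Perm (Fin n) × KPf) : Prop :=
  Relation.ReflTransGen (fun a b => PhiEdge n lam mu a b ∨ PhiEdge n lam mu b a) v v'

/-- `(w,β)` has a broken hexagon, broken by `Φ_i` after `Φ_j`. -/
def BrokenHexAt (n : ℕ) (lam mu : ℕ → ℤ) (w : Equiv.Perm (Fin n)) (β : KPf) (i j : ℕ) : Prop :=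
  (j = i + 1 ∨ i = j + 1) ∧ 1 ≤ i ∧ i ≤ n - 1 ∧ 1 ≤ j ∧ j ≤ n - 1 ∧
  0 < pairCo (permAct n w (lamRho n lam)) i ∧
  0 < pairCo (permAct n w (lamRho n lam)) j ∧
  iterO (eop n i) (pairCo (permAct n w (lamRho n lam)) i).toNat β ≠ none ∧
  ∃ δ, iterO (eop n j) (pairCo (permAct n w (lamRho n lam)) j).toNat β = some δ ∧
    epsS n i δ < (pairCo (permAct n w (lamRho n lam)) i).toNat +
      (pairCo (permAct n w (lamRho n lam)) j).toNat

/-- `γ` is obtained from `β` by an initial segment of the operator sequence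
(`e_i` applied `ki` times, then `e_j` applied `ki+kj` times, then `e_i` applied
`kj` times). -/
def alongPath (n i j ki kj : ℕ) (β γ : KPf) : Prop :=
  (∃ a ≤ ki, iterO (eop n i) a β = some γ) ∨
  (∃ b ≤ ki + kj, (iterO (eop n i) ki β).bind (iterO (eop n j) b) = some γ) ∨
  (∃ c ≤ kj, ((iterO (eop n i) ki β).bind (iterO (eop n j) (ki + kj))).bind
      (iterO (eop n i) c) = some γ)

/-- Conjecture A: no broken diamonds along the hexagon paths. -/
def ConjA (n : ℕ) (lam mu : ℕ → ℤ) : Prop :=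
  ∀ (w : Equiv.Perm (Fin n)) (β : KPf) (i j : ℕ),
    InS n lam mu w β → 1 ≤ i → i ≤ n - 1 → 1 ≤ j → j ≤ n - 1 → (j = i + 1 ∨ i = j + 1) →
    ∀ ki kj : ℤ,
      ki = pairCo (permAct n w (lamRho n lam)) i →
      kj = pairCo (permAct n w (lamRho n lam)) j →
      0 < ki → 0 < kj →
      iterO (eop n i) ki.toNat β ≠ none → iterO (eop n j) kj.toNat β ≠ none →
      ∀ γ : KPf,
        (alongPath n i j ki.toNat kj.toNat β γ ∨ alongPath n j i kj.toNat ki.toNat β γ) →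
        ¬ (simZero2 n i j γ ∧ simZero2 n j i γ)

/-- Conjecture B: broken hexagons propagate up to the source vertex. -/
def ConjB (n : ℕ) (lam mu : ℕ → ℤ) : Prop :=
  ∀ (w : Equiv.Perm (Fin n)) (β α : KPf) (i j : ℕ),
    InS n lam mu w β → InS n lam mu 1 α → Conn n lam mu (1, α) (w, β) →
    BrokenHexAt n lam mu w β i j → ∃ j', BrokenHexAt n lam mu 1 α i j'

/-- The Kostka–Foulkes polynomial `K_{λ,μ}(t) = Σ_{(w,α) ∈ S_{λ,μ}} sgn(w) t^{|α|}`. -/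
noncomputable def KF (n : ℕ) (lam mu : ℕ → ℤ) : Polynomial ℤ :=
  ∑ᶠ (w : Equiv.Perm (Fin n)) (α : KPf) (_ : InS n lam mu w α),
    ((Equiv.Perm.sign w : ℤ) • (Polynomial.X ^ kpSize n α) : Polynomial ℤ)

end KFC


namespace KFC

section Words

theorem reduceW_append_singleton (w : List Entry) (e : Entry) :
    reduceW (w ++ [e]) = redStep (reduceW w) e := by
  simp [reduceW]

theorem redStep_filter_plus (s : List Entry) (e : Entry) :
    (redStep s e).filter (fun e => e.1) = s.filter (fun e => e.1) ∨
      (e.1 = true ∧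
        (redStep s e).filter (fun e => e.1) = s.filter (fun e => e.1) ++ [e]) := by
  obtain ⟨b, r⟩ := e
  rcases List.eq_nil_or_concat s with rfl | ⟨s, ⟨c, r'⟩, rfl⟩
  · cases b <;> simp [redStep]
  · cases b <;> cases c <;> simp [redStep]

theorem plusCt_redStep_sub_minusCt (s : List Entry) (e : Entry) :
    (plusCt (redStep s e) : ℤ) - minusCt (redStep s e) =
      plusCt s - minusCt s + (plusCt [e] - minusCt [e]) := by
  obtain ⟨b, r⟩ := e
  rcases List.eq_nil_or_concat s with rfl | ⟨s, ⟨c, r'⟩, rfl⟩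
  · cases b <;> simp [redStep, plusCt, minusCt]
  · cases b <;> cases c <;> simp [redStep, plusCt, minusCt] <;> ring

theorem plusCt_append (w w' : List Entry) : plusCt (w ++ w') = plusCt w + plusCt w' := by
  simp [plusCt]

theorem minusCt_append (w w' : List Entry) : minusCt (w ++ w') = minusCt w + minusCt w' := by
  simp [minusCt]

/-- Reduction preserves the number of plus signs minus the number of minus signs. -/
theorem plusCt_reduceW_sub_minusCt (w : List Entry) :
    (plusCt (reduceW w) : ℤ) - minusCt (reduceW w) = plusCt w - minusCt w := by
  induction w using List.reverseRecOn with
  | nil => rfl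
  | append_singleton w e ih =>
    rw [reduceW_append_singleton, plusCt_redStep_sub_minusCt, ih, plusCt_append, minusCt_append]
    push_cast
    ring

theorem plusCt_reduceW_le_of_prefix {w w' : List Entry} (h : w <+: w') :
    plusCt (reduceW w) ≤ plusCt (reduceW w') := by
  obtain ⟨t, rfl⟩ := h
  induction t using List.reverseRecOn with
  | nil => simp
  | append_singleton t e ih =>
    refine ih.trans ?_
    rw [← List.append_assoc, reduceW_append_singleton]
    unfold plusCt
    rcases redStep_filter_plus (reduceW (w ++ t)) e with h | ⟨-, h⟩ <;> rw [h]
    simp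

/-- Everything up to the rightmost surviving plus sign contributes all surviving plus signs. -/
theorem exists_split_of_lastPlus {w : List Entry} {r : Root} (h : lastPlus w = some r) :
    ∃ A B, w = A ++ (true, r) :: B ∧ plusCt (reduceW w) ≤ plusCt (reduceW A) + 1 := by
  induction w using List.reverseRecOn with
  | nil => simp [lastPlus, reduceW] at h
  | append_singleton w e ih =>
    unfold lastPlus at h
    rw [reduceW_append_singleton] at h ⊢
    rcases redStep_filter_plus (reduceW w) e with h' | ⟨he, h'⟩
    · rw [h'] at h
      obtain ⟨A, B, hw, hc⟩ := ih h
      refine ⟨A, B ++ [e], by rw [hw]; simp, ?_⟩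
      rw [plusCt, h']
      exact hc
    · rw [h'] at h
      obtain ⟨b, r'⟩ := e
      simp only [List.getLast?_append, List.getLast?_singleton, Option.some_or, Option.map_some,
        Option.some.injEq] at h he
      subst h he
      exact ⟨w, [], rfl, by rw [plusCt, h', List.length_append]; rfl⟩

theorem lastPlus_ne_none {w : List Entry} (h : 0 < plusCt (reduceW w)) :
    ∃ r, lastPlus w = some r := by
  rw [← Option.ne_none_iff_exists']
  intro h'
  simp only [lastPlus, Option.map_eq_none_iff, List.getLast?_eq_none_iff] at h'
  simp [plusCt, h'] at h

/-- The word with a block of `p h` letters `(+, f h)` followed by `q h` letters `(−, g h)` for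
each `h` in the list. -/
def blockWord (f g : ℕ → Root) (p q : ℕ → ℕ) (hs : List ℕ) : List Entry :=
  hs.flatMap fun h => List.replicate (p h) (true, f h) ++ List.replicate (q h) (false, g h)

theorem mem_blockWord_true {f g : ℕ → Root} {p q : ℕ → ℕ} {hs : List ℕ} {r : Root} :
    (true, r) ∈ blockWord f g p q hs ↔ ∃ h ∈ hs, p h ≠ 0 ∧ r = f h := by
  simp [blockWord, List.mem_replicate]

theorem prefix_of_split {x : Entry} {P Q A B : List Entry} {p : ℕ} (hQ : x ∉ Q)
    (h : P ++ (List.replicate p x ++ x :: Q) = A ++ x :: B) : A <+: P ++ List.replicate p x := by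
  have h1 : A <+: P ++ (List.replicate p x ++ x :: Q) := h ▸ List.prefix_append _ _
  have h2 : P ++ List.replicate p x <+: P ++ (List.replicate p x ++ x :: Q) := by
    rw [← List.append_assoc]; exact List.prefix_append _ _
  rcases List.prefix_or_prefix_of_prefix h1 h2 with h3 | ⟨C, rfl⟩
  · exact h3
  · rw [← List.append_assoc, List.append_assoc (P ++ List.replicate p x),
      List.append_cancel_left_eq] at h
    cases C with
    | nil => simp
    | cons c C =>
      simp only [List.cons_append, List.cons.injEq] at h
      exact absurd (h.2 ▸ by simp) hQ

/-- Turning a plus sign in the block of the rightmost surviving plus sign into a minus sign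
loses at most one surviving plus sign. -/
theorem blockWord_lastPlus {f g : ℕ → Root} (hf : Function.Injective f) {p q : ℕ → ℕ}
    {hs : List ℕ} (hn : hs.Nodup) {r : Root} (h : lastPlus (blockWord f g p q hs) = some r) :
    ∃ k ∈ hs, r = f k ∧ p k ≠ 0 ∧ ∀ p' q' : ℕ → ℕ, p' k = p k - 1 →
      (∀ j, j ≠ k → p' j = p j ∧ q' j = q j) →
      plusCt (reduceW (blockWord f g p q hs)) ≤
        plusCt (reduceW (blockWord f g p' q' hs)) + 1 := by
  obtain ⟨A, B, hw, hc⟩ := exists_split_of_lastPlus h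
  obtain ⟨k, hk, hpk, rfl⟩ := mem_blockWord_true.1
    (show (true, r) ∈ blockWord f g p q hs by rw [hw]; simp)
  refine ⟨k, hk, rfl, hpk, fun p' q' hp' hq' => hc.trans ?_⟩
  gcongr
  apply plusCt_reduceW_le_of_prefix
  obtain ⟨l₁, l₂, rfl⟩ := List.append_of_mem hk
  obtain ⟨m, hm⟩ := Nat.exists_eq_succ_of_ne_zero hpk
  have hk₁ : k ∉ l₁ := fun hmem => by
    have := List.disjoint_of_nodup_append hn hmem
    simp at this
  have hk₂ : k ∉ l₂ := (List.nodup_cons.1 (List.Nodup.of_append_right hn)).1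
  have e₁ : blockWord f g p' q' l₁ = blockWord f g p q l₁ := by
    unfold blockWord
    refine List.flatMap_congr fun j hj => ?_
    have := hq' j (by rintro rfl; exact hk₁ hj)
    rw [this.1, this.2]
  have key : A <+: blockWord f g p q l₁ ++ List.replicate m (true, f k) := by
    refine prefix_of_split
      (Q := List.replicate (q k) (false, g k) ++ blockWord f g p q l₂) (B := B) ?_ ?_
    · rw [List.mem_append, mem_blockWord_true]
      rintro (h | ⟨j, hj, -, hj'⟩)
      · simp [List.mem_replicate] at h
      · exact hk₂ (hf hj' ▸ hj)
    · rw [← hw]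
      simp [blockWord, hm, List.replicate_succ']
  refine key.trans ?_
  rw [← e₁, show m = p' k by omega]
  simp [blockWord]

theorem plusCt_blockWord (f g : ℕ → Root) (p q : ℕ → ℕ) (hs : List ℕ) :
    plusCt (blockWord f g p q hs) = (hs.map p).sum := by
  induction hs with
  | nil => rfl
  | cons h hs ih =>
    rw [List.map_cons, List.sum_cons, ← ih]
    simp [blockWord, plusCt]

theorem minusCt_blockWord (f g : ℕ → Root) (p q : ℕ → ℕ) (hs : List ℕ) :
    minusCt (blockWord f g p q hs) = (hs.map q).sum := by
  induction hs with
  | nil => rfl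
  | cons h hs ih =>
    rw [List.map_cons, List.sum_cons, ← ih]
    simp [blockWord, minusCt]

theorem Wword_eq_blockWord (n i : ℕ) (α : KPf) :
    Wword n i α = blockWord (fun h => (h, i)) (fun h => (h, i + 1)) (fun h => α (h, i))
      (fun h => α (h, i + 1)) (List.range (n + 1)).reverse := rfl

theorem Wstar_eq_blockWord (n i : ℕ) (α : KPf) :
    Wstar n i α = blockWord (fun j => (i + 1, j)) (fun j => (i, j)) (fun j => α (i + 1, j))
      (fun j => α (i, j)) (List.range (n + 1)) := rfl

theorem blockWord_congr {f g : ℕ → Root} {p q p' q' : ℕ → ℕ} {hs : List ℕ}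
    (h : ∀ k ∈ hs, p k = p' k ∧ q k = q' k) :
    blockWord f g p q hs = blockWord f g p' q' hs := by
  unfold blockWord
  refine List.flatMap_congr fun k hk => ?_
  rw [(h k hk).1, (h k hk).2]

end Words

section Weights

theorem sum_range_list (m : ℕ) (p : ℕ → ℕ) :
    ((List.range m).map p).sum = ∑ h ∈ Finset.range m, p h := by
  induction m with
  | zero => rfl
  | succ m ih => simp [List.range_succ, Finset.sum_range_succ, ih]

theorem aSt_sub_bSt (n i : ℕ) (α : KPf) : (aSt n i α : ℤ) - bSt n i α =
    ∑ h ∈ Finset.range (n + 1), (α (h, i) : ℤ) -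
      ∑ h ∈ Finset.range (n + 1), (α (h, i + 1) : ℤ) := by
  rw [aSt, bSt, plusCt_reduceW_sub_minusCt, Wword_eq_blockWord, plusCt_blockWord,
    minusCt_blockWord, List.map_reverse, List.map_reverse, List.sum_reverse, List.sum_reverse,
    sum_range_list, sum_range_list]
  push_cast
  rfl

theorem aStar_sub_bStar (n i : ℕ) (α : KPf) : (aStar n i α : ℤ) - bStar n i α =
    ∑ j ∈ Finset.range (n + 1), (α (i + 1, j) : ℤ) -
      ∑ j ∈ Finset.range (n + 1), (α (i, j) : ℤ) := by
  rw [aStar, bStar, plusCt_reduceW_sub_minusCt, Wstar_eq_blockWord, plusCt_blockWord,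
    minusCt_blockWord, sum_range_list, sum_range_list]
  push_cast
  rfl

theorem kpEval_eq {n k : ℕ} (hk : k ≤ n) (α : KPf) : kpEval n α k =
    ∑ j ∈ Finset.range (n + 1), (α (k, j) : ℤ) -
      ∑ h ∈ Finset.range (n + 1), (α (h, k) : ℤ) := by
  have hk' : k ∈ Finset.range (n + 1) := by simp; omega
  simp only [kpEval, kbox, mul_sub, Finset.sum_sub_distrib, mul_ite, mul_one, mul_zero]
  congr 1
  · rw [Finset.sum_product_right]
    refine Finset.sum_congr rfl fun j _ => ?_
    simp [Finset.sum_ite_eq', hk']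
  · rw [Finset.sum_product]
    refine Finset.sum_congr rfl fun j _ => ?_
    simp [Finset.sum_ite_eq', hk']

theorem pairCo_kpEval {n i : ℕ} (hi : i + 1 ≤ n) (α : KPf) : pairCo (kpEval n α) i =
    bSt n i α - aSt n i α + (bStar n i α - aStar n i α) := by
  have h₁ := aSt_sub_bSt n i α
  have h₂ := aStar_sub_bStar n i α
  rw [pairCo, kpEval_eq (by omega), kpEval_eq hi]
  linarith

theorem kpEval_KPmove {n : ℕ} {α : KPf} {r r' : Root} (hr : r ∈ kbox n) (hr' : r' ∈ kbox n)
    (h : α r ≠ 0) (k : ℕ) : kpEval n (KPmove α r r') k = kpEval n α k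
      + (((if r'.1 = k then 1 else 0) - (if r'.2 = k then 1 else 0))
        - ((if r.1 = k then 1 else 0) - (if r.2 = k then 1 else 0))) := by
  have e : ∀ p, ((KPmove α r r' p : ℕ) : ℤ) =
      α p + (if p = r' then 1 else 0) - (if p = r then 1 else 0) := by
    intro p
    simp only [KPmove, KPadd, KPsub]
    have : p = r → α p ≠ 0 := by rintro rfl; exact h
    split_ifs with h₁ h₂ <;> simp_all <;> omega
  simp only [kpEval, e, add_mul, sub_mul, Finset.sum_add_distrib, Finset.sum_sub_distrib,
    ite_mul, one_mul, zero_mul, Finset.sum_ite_eq', hr, hr', if_true]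
  ring

end Weights

section Operators

theorem IsKP.move {n : ℕ} {α : KPf} (hα : IsKP n α) {r r' : Root} (hr' : IsPos n r') :
    IsKP n (KPmove α r r') := by
  intro p hp
  simp only [KPmove, KPadd, KPsub] at hp
  by_cases h : p = r'
  · exact h ▸ hr'
  · refine hα p fun h0 => hp ?_
    simp [h, h0]

theorem IsPos.mem_kbox {n : ℕ} {r : Root} (h : IsPos n r) : r ∈ kbox n := by
  obtain ⟨h₁, h₂, h₃⟩ := h
  simp only [kbox, Finset.mem_product, Finset.mem_range]
  omega

theorem ftilde_spec {n i : ℕ} (hi : i + 1 ≤ n) {α : KPf} (hα : IsKP n α)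
    (ha : 0 < aSt n i α) : ∃ β, ftilde n i α = some β ∧ IsKP n β ∧
      (∀ k, kpEval n β k = kpEval n α k + srVec i k) ∧ aSt n i α ≤ aSt n i β + 1 ∧
      aStar n i β = aStar n i α ∧ bStar n i β = bStar n i α := by
  obtain ⟨r, hr⟩ := lastPlus_ne_none ha
  obtain ⟨h, -, hrh, hne, hle⟩ := blockWord_lastPlus (f := fun h => (h, i))
    (fun _ _ e => (Prod.mk.inj e).1) (List.nodup_reverse.2 List.nodup_range) hr
  subst hrh
  have hpos := hα _ hne
  have hpos' : IsPos n (h, i + 1) := ⟨hpos.1, Nat.lt_succ_of_lt hpos.2.1, hi⟩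
  have hhi : h < i := hpos.2.1
  have hstar : Wstar n i (KPmove α (h, i) (h, i + 1)) = Wstar n i α := by
    rw [Wstar_eq_blockWord, Wstar_eq_blockWord]
    refine blockWord_congr fun j _ => ?_
    simp only [KPmove, KPadd, KPsub, Prod.mk.injEq]
    constructor <;> split_ifs <;> omega
  refine ⟨KPmove α (h, i) (h, i + 1), by simp only [ftilde, hr], hα.move hpos', fun k => ?_,
    ?_, by rw [aStar, hstar, aStar], by rw [bStar, hstar, bStar]⟩
  · rw [kpEval_KPmove hpos.mem_kbox hpos'.mem_kbox hne]
    simp only [srVec, eq_comm (a := k)]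
    ring
  · refine hle _ _ ?_ fun j hj => ?_
    · simp [KPmove, KPadd, KPsub]
    · simp [KPmove, KPadd, KPsub, hj]

theorem ftildeS_spec {n i : ℕ} (hi₁ : 1 ≤ i) {α : KPf} (hα : IsKP n α)
    (ha : 0 < aStar n i α) : ∃ β, ftildeS n i α = some β ∧ IsKP n β ∧
      (∀ k, kpEval n β k = kpEval n α k + srVec i k) ∧ aStar n i α ≤ aStar n i β + 1 := by
  obtain ⟨r, hr⟩ := lastPlus_ne_none ha
  obtain ⟨j, -, hrj, hne, hle⟩ := blockWord_lastPlus (f := fun j => (i + 1, j))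
    (fun _ _ e => (Prod.mk.inj e).2) List.nodup_range hr
  subst hrj
  have hpos := hα _ hne
  have hpos' : IsPos n (i, j) := ⟨hi₁, Nat.lt_of_succ_lt hpos.2.1, hpos.2.2⟩
  refine ⟨KPmove α (i + 1, j) (i, j), by simp only [ftildeS, hr], hα.move hpos', fun k => ?_, ?_⟩
  · rw [kpEval_KPmove hpos.mem_kbox hpos'.mem_kbox hne]
    simp only [srVec, eq_comm (a := k)]
    ring
  · refine hle _ _ ?_ fun k hk => ?_
    · simp [KPmove, KPadd, KPsub]
    · simp [KPmove, KPadd, KPsub, hk]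

/-- The number of times `f_i` can be applied, as predicted by the reduced words, drops by at most
one under `f_i`. -/
theorem fop_spec {n i : ℕ} (hi₁ : 1 ≤ i) (hi : i + 1 ≤ n) {α : KPf} (hα : IsKP n α)
    (hu : 0 < aStar n i α + (aSt n i α - bStar n i α)) : ∃ β, fop n i α = some β ∧ IsKP n β ∧
      (∀ k, kpEval n β k = kpEval n α k + srVec i k) ∧
      aStar n i α + (aSt n i α - bStar n i α) ≤
        aStar n i β + (aSt n i β - bStar n i β) + 1 := by
  by_cases h : bStar n i α < aSt n i α
  · obtain ⟨β, h₁, h₂, h₃, h₄, h₅, h₆⟩ := ftilde_spec hi hα (by omega)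
    exact ⟨β, by rw [fop, if_pos h, h₁], h₂, h₃, by omega⟩
  · obtain ⟨β, h₁, h₂, h₃, h₄⟩ := ftildeS_spec hi₁ hα (by omega)
    exact ⟨β, by rw [fop, if_neg h, if_pos (by omega), h₁], h₂, h₃, by omega⟩

theorem iterO_fop_spec {n i : ℕ} (hi₁ : 1 ≤ i) (hi : i + 1 ≤ n) (m : ℕ) {α : KPf}
    (hα : IsKP n α) (hu : m ≤ aStar n i α + (aSt n i α - bStar n i α)) :
    ∃ β, iterO (fop n i) m α = some β ∧ IsKP n β ∧
      ∀ k, kpEval n β k = kpEval n α k + m * srVec i k := by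
  induction m generalizing α with
  | zero => exact ⟨α, rfl, hα, by simp⟩
  | succ m ih =>
    obtain ⟨β, h₁, h₂, h₃, h₄⟩ := fop_spec hi₁ hi hα (by omega)
    obtain ⟨γ, h₅, h₆, h₇⟩ := ih h₂ (by omega)
    refine ⟨γ, by rw [iterO, h₁, Option.bind_some, h₅], h₆, fun k => ?_⟩
    rw [h₇, h₃]
    push_cast
    ring

end Operators

section Permutations

/-- Left multiplication by a simple transposition at a descent removes exactly one inversion. -/
theorem lenP_swap_mul {n i : ℕ} (hi : i + 1 < n) (v : Equiv.Perm (Fin n))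
    (h : v⁻¹ ⟨i + 1, hi⟩ < v⁻¹ ⟨i, by omega⟩) :
    lenP n (Equiv.swap ⟨i, by omega⟩ ⟨i + 1, hi⟩ * v) + 1 = lenP n v := by
  classical
  set a : Fin n := ⟨i, by omega⟩ with ha
  set b : Fin n := ⟨i + 1, hi⟩ with hb
  have hva : v (v⁻¹ a) = a := by simp
  have hvb : v (v⁻¹ b) = b := by simp
  have hab : (a : ℕ) + 1 = b := rfl
  have hswap : ∀ x y : Fin n, ¬(x = a ∧ y = b) → ¬(x = b ∧ y = a) →
      (Equiv.swap a b y < Equiv.swap a b x ↔ y < x) := by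
    intro x y h₁ h₂
    simp only [Equiv.swap_apply_def]
    simp only [Fin.ext_iff] at h₁ h₂
    split_ifs <;> simp only [Fin.ext_iff, Fin.lt_def] at * <;> omega
  have key : Finset.univ.filter (fun p : Fin n × Fin n => p.1 < p.2 ∧ v p.2 < v p.1) =
      insert (v⁻¹ b, v⁻¹ a) (Finset.univ.filter (fun p : Fin n × Fin n =>
        p.1 < p.2 ∧ (Equiv.swap a b * v) p.2 < (Equiv.swap a b * v) p.1)) := by
    ext ⟨x, y⟩
    simp only [Finset.mem_filter, Finset.mem_univ, true_and, Finset.mem_insert, Prod.mk.injEq]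
    simp only [Equiv.Perm.mul_apply]
    by_cases h₁ : v x = a ∧ v y = b
    · have hx : x = v⁻¹ a := by rw [← h₁.1]; simp
      have hy : y = v⁻¹ b := by rw [← h₁.2]; simp
      subst hx hy
      have h1 := h.not_gt
      have h2 := h.ne
      simp only [h1, h2, h2.symm, false_and, or_self]
    · by_cases h₂ : v x = b ∧ v y = a
      · have hx : x = v⁻¹ b := by rw [← h₂.1]; simp
        have hy : y = v⁻¹ a := by rw [← h₂.2]; simp
        subst hx hy
        simp only [hva, hvb, h, true_and, and_self, true_or, iff_true, Fin.lt_def]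
        omega
      · rw [hswap _ _ h₁ h₂]
        refine ⟨Or.inr, ?_⟩
        rintro (⟨rfl, rfl⟩ | h')
        · exact absurd ⟨hvb, hva⟩ h₂
        · exact h'
  rw [lenP, lenP, key, Finset.card_insert_of_notMem]
  simp only [Finset.mem_filter, Finset.mem_univ, true_and]
  simp only [Equiv.Perm.mul_apply, hva, hvb, Equiv.swap_apply_left, Equiv.swap_apply_right,
    Fin.lt_def]
  omega

theorem lenP_mul_le (n : ℕ) (v u : Equiv.Perm (Fin n)) : lenP n (v * u) ≤ lenP n v + lenP n u := by
  classical
  set I := fun w : Equiv.Perm (Fin n) =>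
    Finset.univ.filter (fun p : Fin n × Fin n => p.1 < p.2 ∧ w p.2 < w p.1) with hI
  have hsub : I (v * u) ⊆ (I v).image (fun p => (u⁻¹ p.1, u⁻¹ p.2)) ∪ I u := by
    rintro ⟨x, y⟩ hxy
    simp only [hI, Finset.mem_filter, Finset.mem_univ, true_and, Finset.mem_union,
      Finset.mem_image] at hxy ⊢
    simp only [Equiv.Perm.mul_apply] at hxy
    by_cases h : u y < u x
    · exact Or.inr ⟨hxy.1, h⟩
    · refine Or.inl ⟨(u x, u y), ⟨lt_of_le_of_ne (not_lt.1 h) ?_, hxy.2⟩, by simp⟩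
      exact fun e => hxy.1.ne (u.injective e)
  exact (Finset.card_le_card hsub).trans
    ((Finset.card_union_le _ _).trans (Nat.add_le_add_right Finset.card_image_le _))

theorem exists_left_descent {n : ℕ} {v : Equiv.Perm (Fin n)} (hv : v ≠ 1) :
    ∃ (i : ℕ) (hi : i + 1 < n), v⁻¹ ⟨i + 1, hi⟩ < v⁻¹ ⟨i, by omega⟩ := by
  by_contra! H
  refine hv (inv_eq_one.1 (Equiv.ext fun x => ?_))
  obtain _ | n := n
  · exact x.elim0
  have hmono : StrictMono (v⁻¹ : Equiv.Perm (Fin (n + 1))) := by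
    refine Fin.strictMono_iff_lt_succ.2 fun i => ?_
    refine lt_of_le_of_ne (H i (by omega)) fun e => ?_
    have := Fin.ext_iff.1 ((v⁻¹).injective e)
    simp at this
  refine congrFun ((StrictMono.range_inj hmono strictMono_id).1 ?_) x
  rw [(v⁻¹).surjective.range_eq, Set.range_id]

/-- The first step of a descending path from `w` to `u` in the left weak order. -/
theorem leftWeakLE.exists_step {n : ℕ} {u w : Equiv.Perm (Fin n)} (h : leftWeakLE n u w)
    (hne : u ≠ w) : ∃ (i : ℕ) (hi : i + 1 < n), w⁻¹ ⟨i + 1, hi⟩ < w⁻¹ ⟨i, by omega⟩ ∧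
      leftWeakLE n u (sT n (i + 1) * w) ∧ lenP n (sT n (i + 1) * w) < lenP n w := by
  obtain ⟨i, hi, hdes⟩ := exists_left_descent (v := w * u⁻¹)
    fun e => hne (mul_inv_eq_one.1 e).symm
  have hs : sT n (i + 1) = Equiv.swap ⟨i, by omega⟩ ⟨i + 1, hi⟩ := by
    rw [sT, dif_pos ⟨by omega, hi⟩]
    rfl
  have h₁ := lenP_swap_mul hi _ hdes
  rw [← hs] at h₁
  have h₂ := lenP_mul_le n (sT n (i + 1) * (w * u⁻¹)) u
  rw [show sT n (i + 1) * (w * u⁻¹) * u = sT n (i + 1) * w by group] at h₂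
  unfold leftWeakLE at h
  have hw : w⁻¹ ⟨i + 1, hi⟩ < w⁻¹ ⟨i, by omega⟩ := by
    by_contra hcon
    have hlt : w⁻¹ ⟨i, by omega⟩ < w⁻¹ ⟨i + 1, hi⟩ := by
      refine lt_of_le_of_ne (not_lt.1 hcon) fun e => ?_
      have := Fin.ext_iff.1 ((w⁻¹).injective e)
      simp at this
    have h₃ := lenP_swap_mul hi (sT n (i + 1) * w) (by simpa [hs] using hlt)
    rw [← hs, ← mul_assoc, hs, Equiv.swap_mul_self, one_mul, ← hs] at h₃
    omega
  have h₃ := lenP_swap_mul hi _ hw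
  rw [← hs] at h₃
  refine ⟨i, hi, hw, ?_, by omega⟩
  unfold leftWeakLE
  rw [mul_assoc]
  omega

theorem extP_succ {n : ℕ} (w : Equiv.Perm (Fin n)) {k : ℕ} (hk : k < n) :
    extP n w (k + 1) = w ⟨k, hk⟩ + 1 := by
  rw [extP, dif_pos ⟨by omega, hk⟩]
  rfl

theorem permAct_succ {n : ℕ} (w : Equiv.Perm (Fin n)) (v : ℕ → ℤ) {k : ℕ} (hk : k < n) :
    permAct n w v (k + 1) = v (w⁻¹ ⟨k, hk⟩ + 1) := by
  rw [permAct, extP_succ]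

theorem permAct_sT_mul {n i : ℕ} (hi : i + 1 < n) (w : Equiv.Perm (Fin n)) (v : ℕ → ℤ) {k : ℕ}
    (hk₁ : 1 ≤ k) (hk : k ≤ n) : permAct n (sT n (i + 1) * w) v k =
      permAct n w v k + -pairCo (permAct n w v) (i + 1) * srVec (i + 1) k := by
  obtain ⟨k, rfl⟩ := Nat.exists_eq_add_of_le' hk₁
  rw [pairCo, permAct_succ _ _ (show i < n by omega), permAct_succ _ _ hi,
    permAct_succ _ _ (show k < n by omega), permAct_succ _ _ (show k < n by omega), sT,
    dif_pos ⟨by omega, hi⟩]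
  simp only [mul_inv_rev, Equiv.swap_inv, Equiv.Perm.mul_apply, Equiv.swap_apply_def, srVec,
    Fin.mk.injEq, Nat.add_sub_cancel, Nat.add_right_cancel_iff]
  by_cases h₁ : k = i
  · subst h₁
    simp
  · by_cases h₂ : k = i + 1
    · subst h₂
      simp
    · simp [h₁, h₂]

end Permutations

section PhiGraph

theorem lamRho_strictAnti {n : ℕ} {lam : ℕ → ℤ}
    (hlam : ∀ k, 1 ≤ k → k < n → lam (k + 1) ≤ lam k) {a b : ℕ} (ha : 1 ≤ a) (hab : a < b)
    (hb : b ≤ n) : lamRho n lam b < lamRho n lam a := by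
  induction b, hab using Nat.le_induction with
  | base =>
    have := hlam a ha (by omega)
    simp only [lamRho, rhoVec]
    push_cast
    linarith
  | succ b hab ih =>
    have h₁ := ih (by omega)
    have h₂ := hlam b (by omega) (by omega)
    simp only [lamRho, rhoVec] at h₁ ⊢
    push_cast
    linarith

/-- Every descent of `w` gives an outgoing edge of the `Φ`-graph at `(w, α)`. -/
theorem exists_phiEdge {n : ℕ} {lam mu : ℕ → ℤ}
    (hlam : ∀ k, 1 ≤ k → k < n → lam (k + 1) ≤ lam k)
    (hmu : ∀ k, 1 ≤ k → k < n → mu (k + 1) ≤ mu k) {w : Equiv.Perm (Fin n)} {α : KPf}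
    (hwα : InS n lam mu w α) {i : ℕ} (hi : i + 1 < n)
    (hdes : w⁻¹ ⟨i + 1, hi⟩ < w⁻¹ ⟨i, by omega⟩) :
    ∃ β, PhiEdge n lam mu (w, α) (sT n (i + 1) * w, β) := by
  have hneg : pairCo (permAct n w (lamRho n lam)) (i + 1) < 0 := by
    rw [pairCo, permAct_succ _ _ (show i < n by omega), permAct_succ _ _ hi, sub_neg]
    exact lamRho_strictAnti hlam (by omega) (Nat.add_lt_add_right hdes 1) (by omega)
  set K := pairCo (permAct n w (lamRho n lam)) (i + 1) with hK
  have hpair : pairCo (kpEval n α) (i + 1) = K - (mu (i + 1) - mu (i + 1 + 1) + 1) := by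
    rw [hK, pairCo, pairCo, hwα.2 _ (by omega) (by omega), hwα.2 _ (by omega) (by omega)]
    simp only [rhoVec]
    push_cast
    ring
  rw [pairCo_kpEval hi] at hpair
  have hmu' := hmu (i + 1) (by omega) hi
  obtain ⟨β, h₁, h₂, h₃⟩ := iterO_fop_spec (i := i + 1) (by omega) hi (-K).toNat hwα.1 (by omega)
  refine ⟨β, hwα, ⟨h₂, fun k hk₁ hk => ?_⟩, i + 1, by omega, by omega, hneg, rfl, h₁⟩
  rw [h₃, hwα.2 k hk₁ hk, permAct_sT_mul hi w _ hk₁ hk, ← hK, Int.toNat_of_nonneg (by omega)]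
  ring

end PhiGraph

end KFC

open KFC in
/-- Connected components of the `Φ`-graph are downward closed under the left
weak Bruhat order: if `(w,α)` is a vertex and `u ≤ w`, then some `(u,β)` lies
in the same component. -/
theorem stmt2 (n : ℕ) (hn : 2 ≤ n) (lam mu : ℕ → ℤ)
    (hlam : ∀ k, 1 ≤ k → k < n → lam (k+1) ≤ lam k) (hlamn : lam n = 0)
    (hmu : ∀ k, 1 ≤ k → k < n → mu (k+1) ≤ mu k) (hmun : 0 ≤ mu n)
    (hcomb : ∃ c : ℕ → ℕ, c 0 = 0 ∧ c n = 0 ∧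
      ∀ k, 1 ≤ k → k ≤ n → lam k - mu k = (c k : ℤ) - (c (k-1) : ℤ))
    (w : Equiv.Perm (Fin n)) (α : KPf) (hwα : InS n lam mu w α)
    (u : Equiv.Perm (Fin n)) (hu : leftWeakLE n u w) :
    ∃ β : KPf, InS n lam mu u β ∧ Conn n lam mu (w, α) (u, β) := by
  induction hL : lenP n w using Nat.strong_induction_on generalizing w α with
  | _ L ih =>
    by_cases hne : u = w
    · subst hne
      exact ⟨α, hwα, Relation.ReflTransGen.refl⟩
    · obtain ⟨i, hi, hdes, hu', hlt⟩ := hu.exists_step hne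
      obtain ⟨β, hβ⟩ := exists_phiEdge hlam hmu hwα hi hdes
      obtain ⟨γ, hγ, hconn⟩ := ih _ (hL ▸ hlt) _ β hβ.2.1 hu' rfl
      exact ⟨γ, hγ, Relation.ReflTransGen.head (Or.inl hβ) hconn⟩
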